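/- Let 𝒬_1 and 𝒬_2 be UCQs with 𝒬_2 ⊨ 𝒬_1, and let R be a disjunctive rule. For any disjunctive piece-unifier μ_∨^2 of 𝒬_2 with R: either β_∨(𝒬_2, R, μ_∨^2) ⊨ 𝒬_1, or there is a disjunctive piece-unifier μ_∨^1 of 𝒬_1 with R such that β_∨(𝒬_2, R, μ_∨^2) ⊨ β_∨(𝒬_1, R, μ_∨^1). -/

import Mathlib

/-! ## Basic syntax: terms, atoms, substitutions -/

/-- A term over variables `V` and constants `C`. -/
inductive FOTerm (V C : Type) where
  | var (v : V)
  | const (c : C)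
deriving DecidableEq

/-- An atom `p(t_1,...,t_n)`. -/
structure FOAtom (P V C : Type) where
  pred : P
  args : List (FOTerm V C)
deriving DecidableEq

/-- A substitution of variables by terms. -/
abbrev FOSubst (V C : Type) := V → FOTerm V C

variable {P V C : Type}

def FOTerm.applySub (u : FOSubst V C) : FOTerm V C → FOTerm V C
  | FOTerm.var v => u v
  | FOTerm.const c => FOTerm.const c

def FOAtom.applySub (u : FOSubst V C) (a : FOAtom P V C) : FOAtom P V C :=
  ⟨a.pred, a.args.map (FOTerm.applySub u)⟩

def applySubFS [DecidableEq P] [DecidableEq V] [DecidableEq C]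
    (u : FOSubst V C) (S : Finset (FOAtom P V C)) : Finset (FOAtom P V C) :=
  S.image (FOAtom.applySub u)

def FOTerm.varsOf [DecidableEq V] : FOTerm V C → Finset V
  | FOTerm.var v => {v}
  | FOTerm.const _ => ∅

def FOAtom.varsOf [DecidableEq V] (a : FOAtom P V C) : Finset V :=
  a.args.foldr (fun t acc => t.varsOf ∪ acc) ∅

/-- Variables occurring in a finite set of atoms. -/
def varsFS [DecidableEq V] (S : Finset (FOAtom P V C)) : Finset V :=
  S.sup FOAtom.varsOf

/-- Terms occurring in a finite set of atoms. -/
def termsFS [DecidableEq V] [DecidableEq C] (S : Finset (FOAtom P V C)) :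
    Finset (FOTerm V C) :=
  S.sup (fun a => a.args.toFinset)

/-- `h` is a homomorphism from the atom set `S₁` to the atom set `S₂`. -/
def IsHom (h : FOSubst V C) (S₁ S₂ : Finset (FOAtom P V C)) : Prop :=
  ∀ a ∈ S₁, a.applySub h ∈ S₂

/-- `S₂ ⊨ S₁` for atom sets viewed as existentially closed conjunctions:
there is a homomorphism from `S₁` to `S₂`. -/
def EntailsFS (S₂ S₁ : Finset (FOAtom P V C)) : Prop :=
  ∃ h : FOSubst V C, IsHom h S₁ S₂

/-! ## Disjunctive existential rules, triggers, chase step α -/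

/-- A disjunctive existential rule `B → H₁ ∨ ... ∨ Hₙ`. -/
structure DisjRule (P V C : Type) where
  body : Finset (FOAtom P V C)
  heads : List (Finset (FOAtom P V C))

/-- Well-formedness: non-empty body, at least one head disjunct, non-empty disjuncts. -/
def DisjRule.WF (R : DisjRule P V C) : Prop :=
  R.body.Nonempty ∧ R.heads ≠ [] ∧ ∀ H ∈ R.heads, H.Nonempty

/-- All variables of a rule. -/
def DisjRule.vars [DecidableEq V] (R : DisjRule P V C) : Finset V :=
  varsFS R.body ∪ R.heads.foldr (fun H acc => varsFS H ∪ acc) ∅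

/-- A trigger `(R, h)` on `F`: `h` is a homomorphism from the body of `R` to `F`. -/
def IsTrigger (R : DisjRule P V C) (h : FOSubst V C) (F : Finset (FOAtom P V C)) : Prop :=
  IsHom h R.body F

/-- `h'` is a safe extension of `h` for the head disjunct `H` of rule `R` w.r.t. the
fact base `F`: it agrees with `h` outside the existential variables of `H` and renames
the existential variables of `H` injectively to fresh variables. -/
def IsSafeExt [DecidableEq V] (F : Finset (FOAtom P V C)) (R : DisjRule P V C)
    (H : Finset (FOAtom P V C)) (h h' : FOSubst V C) : Prop :=
  (∀ v : V, v ∉ varsFS H \ varsFS R.body → h' v = h v) ∧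
  (∀ v ∈ varsFS H \ varsFS R.body, ∃ w : V, h' v = FOTerm.var w ∧ w ∉ varsFS F) ∧
  (∀ v ∈ varsFS H \ varsFS R.body, ∀ v' ∈ varsFS H \ varsFS R.body,
      h' v = h' v' → v = v')

/-- `L` is a result of the application `α_∨(F, R, h)` of the trigger `(R, h)` on `F`:
its `i`-th element is `F ∪ h^{safeᵢ}(Hᵢ)`. -/
def IsAlpha [DecidableEq P] [DecidableEq V] [DecidableEq C]
    (F : Finset (FOAtom P V C)) (R : DisjRule P V C) (h : FOSubst V C)
    (L : List (Finset (FOAtom P V C))) : Prop :=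
  L.length = R.heads.length ∧
  ∀ (i : ℕ) (hi : i < L.length) (hi' : i < R.heads.length),
    ∃ h' : FOSubst V C, IsSafeExt F R (R.heads.get ⟨i, hi'⟩) h h' ∧
      L.get ⟨i, hi⟩ = F ∪ applySubFS h' (R.heads.get ⟨i, hi'⟩)

/-! ## Partitions of terms (as equivalence relations), piece-unifiers -/

/-- A relation on terms, representing a partition of a set of terms (two terms are
related iff they belong to the same class). -/
abbrev TRel (V C : Type) := FOTerm V C → FOTerm V C → Prop

/-- Admissibility of a partition: no class contains two distinct constants. -/
def RelAdmissible (r : TRel V C) : Prop :=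
  ∀ c c' : C, r (FOTerm.const c) (FOTerm.const c') → c = c'

/-- `u` is a substitution associated with the partition represented by `r`:
it is constant on classes, maps each term to a member of its class (the selected term),
and gives priority to constants. -/
def IsAssocSub (r : TRel V C) (u : FOSubst V C) : Prop :=
  (∀ s t, r s t → s.applySub u = t.applySub u) ∧
  (∀ t, r t (t.applySub u)) ∧
  (∀ (v : V) (c : C), r (FOTerm.var v) (FOTerm.const c) → u v = FOTerm.const c)

/-- The data of a piece-unifier `(Q', H', P_u)`. -/
structure PieceUnif (P V C : Type) where
  Q' : Finset (FOAtom P V C)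
  H' : Finset (FOAtom P V C)
  rel : TRel V C

/-- `μ` is a piece-unifier of the CQ `Q` with the conjunctive rule `B → H`. -/
def IsPieceUnifier [DecidableEq P] [DecidableEq V] [DecidableEq C]
    (Q : Finset (FOAtom P V C)) (B H : Finset (FOAtom P V C))
    (μ : PieceUnif P V C) : Prop :=
  μ.Q'.Nonempty ∧ μ.Q' ⊆ Q ∧ μ.H' ⊆ H ∧
  Equivalence μ.rel ∧
  -- the partition is on the terms of Q' and H' (all other classes are singletons)
  (∀ s t, μ.rel s t → s = t ∨
      (s ∈ termsFS μ.Q' ∪ termsFS μ.H' ∧ t ∈ termsFS μ.Q' ∪ termsFS μ.H')) ∧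
  RelAdmissible μ.rel ∧
  -- classes containing an existential variable of H' contain otherwise only
  -- non-separating variables of Q'
  (∀ z ∈ varsFS μ.H' \ varsFS B, ∀ t, μ.rel (FOTerm.var z) t → t = FOTerm.var z ∨
      ∃ v : V, t = FOTerm.var v ∧ FOTerm.var v ∈ termsFS μ.Q' ∧ v ∉ varsFS (Q \ μ.Q')) ∧
  -- unification condition
  (∀ u : FOSubst V C, IsAssocSub μ.rel u → applySubFS u μ.Q' = applySubFS u μ.H')

/-- The join of a list of partitions (represented as relations): the equivalence
relation generated by their union. -/
def joinRel (rs : List (TRel V C)) : TRel V C :=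
  Relation.EqvGen (fun s t => ∃ r ∈ rs, r s t)

/-- The data of a disjunctive piece-unifier: the safe copies `Q₁, ..., Qₙ` together
with the conjunctive piece-unifiers `μ₁, ..., μₙ`. -/
structure DisjPieceUnif (P V C : Type) where
  Qs : List (Finset (FOAtom P V C))
  mus : List (PieceUnif P V C)

/-- The join of the partitions of a disjunctive piece-unifier. -/
def DisjPieceUnif.rel (μ : DisjPieceUnif P V C) : TRel V C :=
  joinRel (μ.mus.map PieceUnif.rel)

/-- `Qc` is a safe copy of `Q` (bijective renaming of its variables). -/
def IsSafeCopy [DecidableEq P] [DecidableEq V] [DecidableEq C]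
    (Q Qc : Finset (FOAtom P V C)) : Prop :=
  ∃ ρ : V → V, Function.Injective ρ ∧
    Qc = Q.image (FOAtom.applySub (fun v => FOTerm.var (ρ v)))

/-- `μ` is a disjunctive piece-unifier of the UCQ `𝒬` with the disjunctive rule `R`. -/
def IsDisjPieceUnifier [DecidableEq P] [DecidableEq V] [DecidableEq C]
    (𝒬 : Set (Finset (FOAtom P V C))) (R : DisjRule P V C)
    (μ : DisjPieceUnif P V C) : Prop :=
  μ.Qs.length = R.heads.length ∧ μ.mus.length = R.heads.length ∧
  -- each Qᵢ is a safe copy of a CQ of 𝒬, with variables disjoint from the rule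
  -- and from the other copies
  (∀ (i : ℕ) (hi : i < μ.Qs.length), ∃ Q ∈ 𝒬, IsSafeCopy Q (μ.Qs.get ⟨i, hi⟩)) ∧
  (∀ (i : ℕ) (hi : i < μ.Qs.length), Disjoint (varsFS (μ.Qs.get ⟨i, hi⟩)) R.vars) ∧
  (∀ (i j : ℕ) (hi : i < μ.Qs.length) (hj : j < μ.Qs.length), i ≠ j →
      Disjoint (varsFS (μ.Qs.get ⟨i, hi⟩)) (varsFS (μ.Qs.get ⟨j, hj⟩))) ∧
  -- each μᵢ is a piece-unifier of Qᵢ with B → Hᵢ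
  (∀ (i : ℕ) (hi : i < R.heads.length) (hi1 : i < μ.Qs.length) (hi2 : i < μ.mus.length),
      IsPieceUnifier (μ.Qs.get ⟨i, hi1⟩) R.body (R.heads.get ⟨i, hi⟩)
        (μ.mus.get ⟨i, hi2⟩)) ∧
  -- the join of the partitions is admissible
  RelAdmissible μ.rel

/-- `β_∨(𝒬, R, μ) = u(B) ∪ ⋃ᵢ u(Qᵢ ∖ Qᵢ')`, for `u` a substitution associated with
the join of the partitions of `μ`. -/
def betaRw [DecidableEq P] [DecidableEq V] [DecidableEq C]
    (R : DisjRule P V C) (μ : DisjPieceUnif P V C) (u : FOSubst V C) :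
    Finset (FOAtom P V C) :=
  applySubFS u R.body ∪
    (List.zipWith (fun Qi m => applySubFS u (Qi \ PieceUnif.Q' m)) μ.Qs μ.mus).foldr
      (· ∪ ·) ∅

/-! ## Semantics -/

/-- A first-order interpretation (with non-empty domain). -/
structure Interp (P V C : Type) where
  dom : Type
  nonempty : Nonempty dom
  rel : P → List dom → Prop
  cst : C → dom

def Interp.evalT (I : Interp P V C) (a : V → I.dom) : FOTerm V C → I.dom
  | FOTerm.var v => a v
  | FOTerm.const c => I.cst c

def Interp.satAtom (I : Interp P V C) (a : V → I.dom) (atm : FOAtom P V C) : Prop :=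
  I.rel atm.pred (atm.args.map (I.evalT a))

def Interp.satFS (I : Interp P V C) (a : V → I.dom) (S : Finset (FOAtom P V C)) : Prop :=
  ∀ atm ∈ S, I.satAtom a atm

/-- `I` is a model of the atom set `S` viewed as an existentially closed conjunction. -/
def Interp.modelsFB [DecidableEq V] (I : Interp P V C) (S : Finset (FOAtom P V C)) : Prop :=
  ∃ a : V → I.dom, I.satFS a S

/-- `I` satisfies the disjunctive existential rule `R`. -/
def Interp.satRule [DecidableEq V] (I : Interp P V C) (R : DisjRule P V C) : Prop :=
  ∀ a : V → I.dom, I.satFS a R.body →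
    ∃ H ∈ R.heads, ∃ a' : V → I.dom,
      (∀ v ∈ varsFS R.body, a' v = a v) ∧ I.satFS a' H

/-- First-order entailment `F, ℛ ⊨ 𝒬` of a UCQ from a fact base and a set of
disjunctive existential rules. -/
def SemEntails [DecidableEq V] (F : Finset (FOAtom P V C)) (ℛ : Set (DisjRule P V C))
    (𝒬 : Set (Finset (FOAtom P V C))) : Prop :=
  ∀ I : Interp P V C, I.modelsFB F → (∀ R ∈ ℛ, I.satRule R) →
    ∃ Q ∈ 𝒬, I.modelsFB Q

/-! ## Piece-rewriting -/

/-- `IsPieceRewriting ℛ 𝒬 𝒬'` holds when the UCQ `𝒬'` is obtained from the UCQ `𝒬`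
by a finite sequence of one-step piece-rewritings with rules of `ℛ`. -/
inductive IsPieceRewriting [DecidableEq P] [DecidableEq V] [DecidableEq C]
    (ℛ : Set (DisjRule P V C)) :
    Finset (Finset (FOAtom P V C)) → Finset (Finset (FOAtom P V C)) → Prop
  | refl (𝒬 : Finset (Finset (FOAtom P V C))) : IsPieceRewriting ℛ 𝒬 𝒬
  | step (𝒬 𝒬' : Finset (Finset (FOAtom P V C))) (R : DisjRule P V C)
      (μ : DisjPieceUnif P V C) (u : FOSubst V C) :
      IsPieceRewriting ℛ 𝒬 𝒬' → R ∈ ℛ →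
      IsDisjPieceUnifier (↑𝒬' : Set (Finset (FOAtom P V C))) R μ →
      IsAssocSub μ.rel u →
      IsPieceRewriting ℛ 𝒬 (insert (betaRw R μ u) 𝒬')

/-! ## Substitutions and occurrences of terms -/

theorem FOTerm.applySub_applySub (u v : FOSubst V C) (t : FOTerm V C) :
    (t.applySub u).applySub v = t.applySub (fun x => (u x).applySub v) := by
  cases t <;> rfl

theorem FOAtom.applySub_applySub (u v : FOSubst V C) (a : FOAtom P V C) :
    (a.applySub u).applySub v = a.applySub (fun x => (u x).applySub v) := by
  simp [FOAtom.applySub, Function.comp_def, FOTerm.applySub_applySub]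

theorem FOAtom.applySub_congr {u v : FOSubst V C} {a : FOAtom P V C}
    (h : ∀ t ∈ a.args, t.applySub u = t.applySub v) : a.applySub u = a.applySub v := by
  simpa [FOAtom.applySub] using h

/-- Two atoms have the same predicate and pairwise related arguments. -/
def FOAtom.Related (r : TRel V C) (a b : FOAtom P V C) : Prop :=
  a.pred = b.pred ∧ List.Forall₂ r a.args b.args

theorem FOAtom.applySub_eq_applySub_iff {u : FOSubst V C} {a b : FOAtom P V C} :
    a.applySub u = b.applySub u ↔
      a.Related (fun s t => s.applySub u = t.applySub u) b := by
  simp [FOAtom.applySub, FOAtom.Related, ← List.forall₂_eq_eq_eq, List.forall₂_map_left_iff,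
    List.forall₂_map_right_iff]

theorem FOAtom.Related.mono {r r' : TRel V C} {a b : FOAtom P V C} (hab : a.Related r b)
    (h : ∀ s ∈ a.args, ∀ t ∈ b.args, r s t → r' s t) : a.Related r' b := by
  refine ⟨hab.1, ?_⟩
  have h2 := hab.2
  rw [List.forall₂_iff_zip] at h2 ⊢
  exact ⟨h2.1, fun hm => h _ (List.of_mem_zip hm).1 _ (List.of_mem_zip hm).2 (h2.2 hm)⟩

theorem FOAtom.related_applySub_left_iff {r : TRel V C} {g : FOSubst V C} {a b : FOAtom P V C} :
    (a.applySub g).Related r b ↔ a.Related (fun s t => r (s.applySub g) t) b := by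
  simp [FOAtom.applySub, FOAtom.Related, List.forall₂_map_left_iff]

theorem FOTerm.mem_varsOf [DecidableEq V] {v : V} {t : FOTerm V C} :
    v ∈ t.varsOf ↔ t = FOTerm.var v := by
  cases t <;> simp [FOTerm.varsOf, eq_comm]

theorem FOAtom.mem_varsOf [DecidableEq V] {v : V} {a : FOAtom P V C} :
    v ∈ a.varsOf ↔ FOTerm.var v ∈ a.args := by
  unfold FOAtom.varsOf
  induction a.args with
  | nil => simp
  | cons t l ih => simp [ih, FOTerm.mem_varsOf, eq_comm]

theorem mem_varsFS [DecidableEq V] {v : V} {S : Finset (FOAtom P V C)} :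
    v ∈ varsFS S ↔ ∃ a ∈ S, FOTerm.var v ∈ a.args := by
  simp [varsFS, Finset.mem_sup, FOAtom.mem_varsOf]

theorem mem_termsFS [DecidableEq V] [DecidableEq C] {t : FOTerm V C}
    {S : Finset (FOAtom P V C)} : t ∈ termsFS S ↔ ∃ a ∈ S, t ∈ a.args := by
  simp [termsFS, Finset.mem_sup]

theorem varsFS_body_subset_vars [DecidableEq V] (R : DisjRule P V C) :
    varsFS R.body ⊆ R.vars :=
  Finset.subset_union_left

theorem varsFS_head_subset_vars [DecidableEq V] (R : DisjRule P V C)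
    {H : Finset (FOAtom P V C)} (hH : H ∈ R.heads) : varsFS H ⊆ R.vars := by
  refine Finset.Subset.trans ?_ Finset.subset_union_right
  revert hH
  induction R.heads with
  | nil => simp
  | cons H' l ih =>
    intro hH
    rcases List.mem_cons.1 hH with rfl | h
    · exact Finset.subset_union_left
    · exact (ih h).trans Finset.subset_union_right

theorem IsHom.mem_varsFS_of_eq_var {g : FOSubst V C} {S₁ S₂ : Finset (FOAtom P V C)}
    [DecidableEq V] (hg : IsHom g S₁ S₂) {w v : V} (hw : w ∈ varsFS S₁)
    (hv : g w = FOTerm.var v) : v ∈ varsFS S₂ := by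
  obtain ⟨a, ha, hwa⟩ := mem_varsFS.1 hw
  refine mem_varsFS.2 ⟨_, hg a ha, ?_⟩
  rw [← hv]
  exact List.mem_map_of_mem (f := FOTerm.applySub g) hwa

theorem FOTerm.applySub_eq_self_of_mem_args [DecidableEq V] {g : FOSubst V C}
    {S : Finset (FOAtom P V C)} (hg : ∀ v ∈ varsFS S, g v = FOTerm.var v)
    {b : FOAtom P V C} (hb : b ∈ S) {t : FOTerm V C} (ht : t ∈ b.args) :
    t.applySub g = t := by
  cases t with
  | var v => exact hg v (mem_varsFS.2 ⟨b, hb, ht⟩)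
  | const c => rfl

/-! ## Associated substitutions -/

theorem exists_isAssocSub {r : TRel V C} (hr : Equivalence r) (hadm : RelAdmissible r) :
    ∃ u : FOSubst V C, IsAssocSub r u := by
  classical
  let S : Setoid (FOTerm V C) := ⟨r, hr⟩
  let sel : FOTerm V C → FOTerm V C := fun t =>
    if h : ∃ c, r t (FOTerm.const c) then FOTerm.const h.choose
    else (Quotient.mk S t).out
  have hsel : ∀ t, r t (sel t) := by
    intro t
    by_cases h : ∃ c, r t (FOTerm.const c)
    · simpa only [sel, dif_pos h] using h.choose_spec
    · simpa only [sel, dif_neg h] using hr.symm (Quotient.mk_out (s := S) t)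
  have hconst : ∀ t c, r t (FOTerm.const c) → sel t = FOTerm.const c := by
    intro t c h
    have h' : ∃ c, r t (FOTerm.const c) := ⟨c, h⟩
    simp only [sel, dif_pos h']
    exact congrArg _ (hadm _ _ (hr.trans (hr.symm h'.choose_spec) h))
  have hcongr : ∀ s t, r s t → sel s = sel t := by
    intro s t hst
    by_cases h : ∃ c, r t (FOTerm.const c)
    · obtain ⟨c, hc⟩ := h
      rw [hconst t c hc, hconst s c (hr.trans hst hc)]
    · have h' : ¬ ∃ c, r s (FOTerm.const c) := fun ⟨c, hc⟩ => h ⟨c, hr.trans (hr.symm hst) hc⟩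
      have hq : Quotient.mk S s = Quotient.mk S t := Quotient.sound hst
      simp only [sel, dif_neg h, dif_neg h', hq]
  have happ : ∀ t : FOTerm V C, t.applySub (fun v => sel (FOTerm.var v)) = sel t := by
    intro t
    cases t with
    | var v => rfl
    | const c => exact (hconst _ c (hr.refl _)).symm
  refine ⟨fun v => sel (FOTerm.var v), ?_, ?_, fun v c h => hconst _ c h⟩
  · intro s t h
    rw [happ, happ, hcongr s t h]
  · intro t
    rw [happ]
    exact hsel t

theorem IsAssocSub.applySub_eq_iff {r : TRel V C} {u : FOSubst V C} (hr : Equivalence r)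
    (hu : IsAssocSub r u) {s t : FOTerm V C} : s.applySub u = t.applySub u ↔ r s t :=
  ⟨fun h => hr.trans (hu.2.1 s) (h ▸ hr.symm (hu.2.1 t)), hu.1 s t⟩

theorem joinRel_equivalence (rs : List (TRel V C)) : Equivalence (joinRel rs) :=
  Relation.EqvGen.is_equivalence _

/-! ## Pulling a piece-unifier back along a homomorphism -/

section Pullback

open Classical in
/-- The pullback of `μ` to the CQ `Q` along a substitution `g`: the atoms of `Q` mapped
by `g` into the unified part of `μ`, the head atoms unified with their images, and the
preimage of the partition of `μ` under `g`. -/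
noncomputable def PieceUnif.pullback (g : FOSubst V C) (Q : Finset (FOAtom P V C))
    (μ : PieceUnif P V C) : PieceUnif P V C where
  Q' := {a ∈ Q | a.applySub g ∈ μ.Q'}
  H' := {b ∈ μ.H' | ∃ a ∈ Q, a.applySub g ∈ μ.Q' ∧ (a.applySub g).Related μ.rel b}
  rel s t := s = t ∨
    ((s ∈ termsFS {a ∈ Q | a.applySub g ∈ μ.Q'} ∪
        termsFS {b ∈ μ.H' | ∃ a ∈ Q, a.applySub g ∈ μ.Q' ∧ (a.applySub g).Related μ.rel b}) ∧
      (t ∈ termsFS {a ∈ Q | a.applySub g ∈ μ.Q'} ∪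
        termsFS {b ∈ μ.H' | ∃ a ∈ Q, a.applySub g ∈ μ.Q' ∧ (a.applySub g).Related μ.rel b}) ∧
      μ.rel (s.applySub g) (t.applySub g))

variable {g : FOSubst V C} {Q : Finset (FOAtom P V C)} {μ : PieceUnif P V C}

theorem PieceUnif.mem_pullback_Q' {a : FOAtom P V C} :
    a ∈ (μ.pullback g Q).Q' ↔ a ∈ Q ∧ a.applySub g ∈ μ.Q' := by
  simp [PieceUnif.pullback]

theorem PieceUnif.mem_pullback_H' {b : FOAtom P V C} :
    b ∈ (μ.pullback g Q).H' ↔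
      b ∈ μ.H' ∧ ∃ a ∈ Q, a.applySub g ∈ μ.Q' ∧ (a.applySub g).Related μ.rel b := by
  simp [PieceUnif.pullback]

theorem PieceUnif.pullback_rel_iff [DecidableEq V] [DecidableEq C] {s t : FOTerm V C} :
    (μ.pullback g Q).rel s t ↔ s = t ∨
      (s ∈ termsFS (μ.pullback g Q).Q' ∪ termsFS (μ.pullback g Q).H' ∧
        t ∈ termsFS (μ.pullback g Q).Q' ∪ termsFS (μ.pullback g Q).H' ∧
        μ.rel (s.applySub g) (t.applySub g)) := by
  simp only [PieceUnif.pullback, Finset.mem_union, mem_termsFS]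

theorem PieceUnif.rel_of_pullback_rel (hμ : Equivalence μ.rel) {s t : FOTerm V C}
    (h : (μ.pullback g Q).rel s t) : μ.rel (s.applySub g) (t.applySub g) := by
  rcases h with rfl | h
  · exact hμ.refl _
  · exact h.2.2

variable [DecidableEq P] [DecidableEq V] [DecidableEq C]

theorem IsPieceUnifier.pullback {Q₂ B H : Finset (FOAtom P V C)}
    (hμ : IsPieceUnifier Q₂ B H μ) (hg : IsHom g Q Q₂)
    (hfix : ∀ v ∈ varsFS H, g v = FOTerm.var v) (hdisj : Disjoint (varsFS Q₂) (varsFS H))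
    (hne : ∃ a ∈ Q, a.applySub g ∈ μ.Q') :
    IsPieceUnifier Q B H (μ.pullback g Q) := by
  obtain ⟨-, hQ', hH', heq, -, hadm, hex, hunif⟩ := hμ
  have hrelated : ∀ {u : FOSubst V C} {a b : FOAtom P V C}, IsAssocSub (μ.pullback g Q).rel u →
      a ∈ Q → a.applySub g ∈ μ.Q' → b ∈ μ.H' → (a.applySub g).Related μ.rel b →
      a.applySub u = b.applySub u := by
    intro u a b hu ha hag hb hab
    refine FOAtom.applySub_eq_applySub_iff.2
      ((FOAtom.related_applySub_left_iff.1 hab).mono fun s hs t ht hst => hu.1 s t ?_)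
    refine PieceUnif.pullback_rel_iff.2 (Or.inr ⟨?_, ?_, ?_⟩)
    · exact Finset.mem_union_left _ (mem_termsFS.2 ⟨a, PieceUnif.mem_pullback_Q'.2 ⟨ha, hag⟩, hs⟩)
    · exact Finset.mem_union_right _
        (mem_termsFS.2 ⟨b, PieceUnif.mem_pullback_H'.2 ⟨hb, a, ha, hag, hab⟩, ht⟩)
    · rwa [FOTerm.applySub_eq_self_of_mem_args hfix (hH' hb) ht]
  refine ⟨?_, ?_, ?_, ?_, ?_, ?_, ?_, ?_⟩
  · obtain ⟨a, ha⟩ := hne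
    exact ⟨a, PieceUnif.mem_pullback_Q'.2 ha⟩
  · exact fun a ha => (PieceUnif.mem_pullback_Q'.1 ha).1
  · exact fun b hb => hH' (PieceUnif.mem_pullback_H'.1 hb).1
  · refine ⟨fun s => Or.inl rfl, ?_, ?_⟩
    · rintro s t (rfl | ⟨h₁, h₂, h₃⟩)
      · exact Or.inl rfl
      · exact Or.inr ⟨h₂, h₁, heq.symm h₃⟩
    · rintro s t r (rfl | ⟨h₁, h₂, h₃⟩) (rfl | ⟨k₁, k₂, k₃⟩)
      · exact Or.inl rfl
      · exact Or.inr ⟨k₁, k₂, k₃⟩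
      · exact Or.inr ⟨h₁, h₂, h₃⟩
      · exact Or.inr ⟨h₁, k₂, heq.trans h₃ k₃⟩
  · intro s t h
    exact (PieceUnif.pullback_rel_iff.1 h).imp id fun h => ⟨h.1, h.2.1⟩
  · intro c c' h
    exact hadm c c' (PieceUnif.rel_of_pullback_rel heq h)
  · intro z hz t hzt
    obtain ⟨hzH', hzB⟩ := Finset.mem_sdiff.1 hz
    obtain ⟨b, hb, hzb⟩ := mem_varsFS.1 hzH'
    have hbH' := (PieceUnif.mem_pullback_H'.1 hb).1
    have hzH : z ∈ varsFS H := mem_varsFS.2 ⟨b, hH' hbH', hzb⟩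
    rcases PieceUnif.pullback_rel_iff.1 hzt with h | ⟨-, ht, hrel⟩
    · exact Or.inl h.symm
    have hcls := hex z (Finset.mem_sdiff.2 ⟨mem_varsFS.2 ⟨b, hbH', hzb⟩, hzB⟩) (t.applySub g)
      (by simpa only [FOTerm.applySub, hfix z hzH] using hrel)
    rcases Finset.mem_union.1 ht with ht | ht
    · obtain ⟨a, ha, hta⟩ := mem_termsFS.1 ht
      obtain ⟨haQ, -⟩ := PieceUnif.mem_pullback_Q'.1 ha
      cases t with
      | const c => rcases hcls with h | ⟨v, h, -⟩ <;> cases h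
      | var w =>
        refine Or.inr ⟨w, rfl, ht, fun hw => ?_⟩
        rcases hcls with h | ⟨v, h, -, hv⟩
        · exact Finset.disjoint_left.1 hdisj
            (hg.mem_varsFS_of_eq_var (mem_varsFS.2 ⟨a, haQ, hta⟩) h) hzH
        · have hg' : IsHom g (Q \ (μ.pullback g Q).Q') (Q₂ \ μ.Q') := fun c hc => by
            rw [Finset.mem_sdiff, PieceUnif.mem_pullback_Q'] at hc
            exact Finset.mem_sdiff.2 ⟨hg c hc.1, fun h => hc.2 ⟨hc.1, h⟩⟩
          exact hv (hg'.mem_varsFS_of_eq_var hw h)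
    · obtain ⟨a, ha, hta⟩ := mem_termsFS.1 ht
      have haH := hH' (PieceUnif.mem_pullback_H'.1 ha).1
      rw [FOTerm.applySub_eq_self_of_mem_args hfix haH hta] at hcls
      refine Or.inl (hcls.resolve_right ?_)
      rintro ⟨v, rfl, hv, -⟩
      obtain ⟨a', ha', hva'⟩ := mem_termsFS.1 hv
      exact Finset.disjoint_left.1 hdisj (mem_varsFS.2 ⟨a', hQ' ha', hva'⟩)
        (mem_varsFS.2 ⟨a, haH, hta⟩)
  · intro u hu
    obtain ⟨w, hw⟩ := exists_isAssocSub heq hadm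
    ext x
    simp only [applySubFS, Finset.mem_image]
    constructor
    · rintro ⟨a, ha, rfl⟩
      obtain ⟨haQ, hag⟩ := PieceUnif.mem_pullback_Q'.1 ha
      have hmem : (a.applySub g).applySub w ∈ applySubFS w μ.H' :=
        hunif w hw ▸ Finset.mem_image_of_mem _ hag
      obtain ⟨b, hb, hab⟩ := Finset.mem_image.1 hmem
      have hrel := (FOAtom.applySub_eq_applySub_iff.1 hab.symm).mono
        fun s _ t _ => (hw.applySub_eq_iff heq).1
      exact ⟨b, PieceUnif.mem_pullback_H'.2 ⟨hb, a, haQ, hag, hrel⟩,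
        (hrelated hu haQ hag hb hrel).symm⟩
    · rintro ⟨b, hb, rfl⟩
      obtain ⟨hbH, a, haQ, hag, hrel⟩ := PieceUnif.mem_pullback_H'.1 hb
      exact ⟨a, PieceUnif.mem_pullback_Q'.2 ⟨haQ, hag⟩, hrelated hu haQ hag hbH hrel⟩

end Pullback

/-! ## Rewritings and fresh renamings -/

theorem mem_foldr_union {α : Type*} [DecidableEq α] {L : List (Finset α)} {x : α} :
    x ∈ L.foldr (· ∪ ·) ∅ ↔ ∃ S ∈ L, x ∈ S := by
  induction L with
  | nil => simp
  | cons S L ih => simp [ih]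

theorem mem_betaRw_iff [DecidableEq P] [DecidableEq V] [DecidableEq C] {R : DisjRule P V C}
    {μ : DisjPieceUnif P V C} {u : FOSubst V C} {x : FOAtom P V C} :
    x ∈ betaRw R μ u ↔ (∃ a ∈ R.body, a.applySub u = x) ∨
      ∃ (i : ℕ) (hi : i < μ.Qs.length) (hi' : i < μ.mus.length),
        ∃ a ∈ μ.Qs[i] \ μ.mus[i].Q', a.applySub u = x := by
  rw [betaRw, Finset.mem_union, mem_foldr_union]
  simp only [applySubFS, Finset.mem_image, List.mem_iff_getElem, List.getElem_zipWith,
    List.length_zipWith, lt_min_iff]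
  refine or_congr_right ⟨?_, ?_⟩
  · rintro ⟨S, ⟨i, hi, rfl⟩, hx⟩
    exact ⟨i, hi.1, hi.2, Finset.mem_image.1 hx⟩
  · rintro ⟨i, hi, hi', hx⟩
    exact ⟨_, ⟨i, ⟨hi, hi'⟩, rfl⟩, Finset.mem_image.2 hx⟩

theorem exists_injective_prod_avoiding {V : Type*} [Infinite V] (S : Finset V) :
    ∃ f : ℕ × V → V, Function.Injective f ∧ ∀ p, f p ∉ S := by
  have hcard : Cardinal.mk (ℕ × V) = Cardinal.mk ((S : Set V)ᶜ : Set V) := by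
    rw [Cardinal.mk_compl_of_infinite _ ((Cardinal.lt_aleph0_of_finite _).trans_le
      (Cardinal.aleph0_le_mk V))]
    simp
  obtain ⟨e⟩ := Cardinal.eq.1 hcard
  exact ⟨fun p => e p, Subtype.val_injective.comp e.injective, fun p => (e p).2⟩

theorem IsSafeCopy.entailsFS [DecidableEq P] [DecidableEq V] [DecidableEq C]
    {Q₁ Q₂ Qc : Finset (FOAtom P V C)} (hc : IsSafeCopy Q₂ Qc) (h : EntailsFS Q₂ Q₁) :
    EntailsFS Qc Q₁ := by
  obtain ⟨ρ, -, rfl⟩ := hc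
  obtain ⟨k, hk⟩ := h
  refine ⟨fun v => (k v).applySub fun v => FOTerm.var (ρ v), fun a ha => ?_⟩
  rw [← FOAtom.applySub_applySub]
  exact Finset.mem_image_of_mem _ (hk a ha)

theorem joinRel.map {rs rs' : List (TRel V C)} {g : FOSubst V C}
    (h : ∀ r ∈ rs, ∃ r' ∈ rs', ∀ s t, r s t → r' (s.applySub g) (t.applySub g))
    {s t : FOTerm V C} (hst : joinRel rs s t) :
    joinRel rs' (s.applySub g) (t.applySub g) := by
  induction hst with
  | rel s t hst =>
    obtain ⟨r, hr, hst⟩ := hst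
    obtain ⟨r', hr', hrr'⟩ := h r hr
    exact .rel _ _ ⟨r', hr', hrr' s t hst⟩
  | refl s => exact .refl _
  | symm s t _ ih => exact .symm _ _ ih
  | trans s t r _ _ ih₁ ih₂ => exact .trans _ _ _ ih₁ ih₂

/-- preservation of entailment by β_∨: if `𝒬₂ ⊨ 𝒬₁` and `μ₂` is a
disjunctive piece-unifier of `𝒬₂` with `R`, then either `β_∨(𝒬₂, R, μ₂) ⊨ 𝒬₁`, or
there is a disjunctive piece-unifier `μ₁` of `𝒬₁` with `R` such that
`β_∨(𝒬₂, R, μ₂) ⊨ β_∨(𝒬₁, R, μ₁)`. -/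
theorem stmt2 {P V C : Type} [DecidableEq P] [DecidableEq V] [DecidableEq C] [Infinite V]
    (𝒬₁ 𝒬₂ : Finset (Finset (FOAtom P V C)))
    (hent : ∀ Q₂ ∈ 𝒬₂, ∃ Q₁ ∈ 𝒬₁, EntailsFS Q₂ Q₁)
    (R : DisjRule P V C) (hWF : R.WF)
    (μ₂ : DisjPieceUnif P V C)
    (hμ₂ : IsDisjPieceUnifier (↑𝒬₂ : Set (Finset (FOAtom P V C))) R μ₂)
    (u₂ : FOSubst V C) (hu₂ : IsAssocSub μ₂.rel u₂) :
    (∃ Q₁ ∈ 𝒬₁, EntailsFS (betaRw R μ₂ u₂) Q₁) ∨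
    (∃ μ₁ : DisjPieceUnif P V C,
       IsDisjPieceUnifier (↑𝒬₁ : Set (Finset (FOAtom P V C))) R μ₁ ∧
       ∃ u₁ : FOSubst V C, IsAssocSub μ₁.rel u₁ ∧
         EntailsFS (betaRw R μ₂ u₂) (betaRw R μ₁ u₁)) := by
  obtain ⟨hlQ, hlm, hcopy, hdR, -, hpu, hadm⟩ := hμ₂
  have hQi : ∀ i : Fin R.heads.length, (i : ℕ) < μ₂.Qs.length := fun i => i.2.trans_eq hlQ.symm
  have hmi : ∀ i : Fin R.heads.length, (i : ℕ) < μ₂.mus.length := fun i => i.2.trans_eq hlm.symm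
  have hcov : ∀ i : Fin R.heads.length, ∃ Q₁ ∈ 𝒬₁, EntailsFS (μ₂.Qs[i]) Q₁ := by
    intro i
    obtain ⟨Q₂, hQ₂, hc⟩ := hcopy i (hQi i)
    obtain ⟨Q₁, hQ₁, he⟩ := hent Q₂ hQ₂
    exact ⟨Q₁, hQ₁, hc.entailsFS he⟩
  choose Q₁ hQ₁ h hh using hcov
  by_cases hcase : ∃ i : Fin R.heads.length, ∀ a ∈ Q₁ i, a.applySub (h i) ∉ (μ₂.mus[i]).Q'
  · obtain ⟨i, hi⟩ := hcase
    refine Or.inl ⟨Q₁ i, hQ₁ i, fun v => (h i v).applySub u₂, fun a ha => ?_⟩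
    rw [← FOAtom.applySub_applySub]
    exact mem_betaRw_iff.2 (Or.inr ⟨i, hQi i, hmi i, _,
      Finset.mem_sdiff.2 ⟨hh i a ha, hi a ha⟩, rfl⟩)
  push Not at hcase
  right
  obtain ⟨f, hf, hfR⟩ := exists_injective_prod_avoiding R.vars
  -- the fresh copies of the CQs of `𝒬₁`, and one substitution `g` acting on all of them
  let cp : Fin R.heads.length → Finset (FOAtom P V C) := fun i =>
    (Q₁ i).image (FOAtom.applySub fun v => FOTerm.var (f (i, v)))
  obtain ⟨g, hgR, hgf⟩ : ∃ g : FOSubst V C, (∀ v ∈ R.vars, g v = FOTerm.var v) ∧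
      ∀ (i : Fin R.heads.length) v, g (f (i, v)) = h i v := by
    refine ⟨fun x => Function.extend (fun p : Fin R.heads.length × V => f (p.1, p.2))
      (fun p => h p.1 p.2) FOTerm.var x, fun v hv => ?_, fun i v => ?_⟩
    · exact Function.extend_apply' _ _ _ fun ⟨p, hp⟩ => hfR _ (hp ▸ hv)
    · refine Function.Injective.extend_apply (f := fun p : Fin R.heads.length × V => f (p.1, p.2))
        (fun p q hpq => ?_) _ _ (i, v)
      have := hf hpq
      simp only [Prod.mk.injEq, Fin.val_inj] at this
      exact Prod.ext this.1 this.2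
  have hcpg : ∀ (i : Fin R.heads.length) (a : FOAtom P V C),
      (a.applySub fun v => FOTerm.var (f (i, v))).applySub g = a.applySub (h i) := by
    intro i a
    rw [FOAtom.applySub_applySub]
    simp only [FOTerm.applySub, hgf]
  have hghom : ∀ i : Fin R.heads.length, IsHom g (cp i) (μ₂.Qs[i]) := by
    intro i b hb
    obtain ⟨a, ha, rfl⟩ := Finset.mem_image.1 hb
    rw [hcpg]
    exact hh i a ha
  have hcpvars : ∀ i, ∀ v ∈ varsFS (cp i), ∃ w, v = f (i, w) := by
    intro i v hv
    obtain ⟨a, ha, hva⟩ := mem_varsFS.1 hv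
    obtain ⟨a, -, rfl⟩ := Finset.mem_image.1 ha
    obtain ⟨t, -, ht⟩ := List.mem_map.1 hva
    cases t with
    | var w => exact ⟨w, (FOTerm.var.inj ht).symm⟩
    | const c => cases ht
  let μ₁ : DisjPieceUnif P V C :=
    ⟨List.ofFn cp, List.ofFn fun i : Fin R.heads.length => (μ₂.mus[i]).pullback g (cp i)⟩
  have hpu₂ : ∀ i : Fin R.heads.length,
      IsPieceUnifier μ₂.Qs[i] R.body R.heads[i] μ₂.mus[i] :=
    fun i => hpu i i.2 (hQi i) (hmi i)
  have hpu₁ : ∀ i : Fin R.heads.length,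
      IsPieceUnifier (cp i) R.body R.heads[i] ((μ₂.mus[i]).pullback g (cp i)) := by
    intro i
    have hsub := varsFS_head_subset_vars R (List.getElem_mem i.2)
    refine (hpu₂ i).pullback (hghom i) (fun v hv => hgR v (hsub hv))
      ((hdR i (hQi i)).mono_right hsub) ?_
    obtain ⟨a, ha, ha'⟩ := hcase i
    exact ⟨_, Finset.mem_image_of_mem _ ha, by rwa [hcpg]⟩
  have hjoin : ∀ {s t}, μ₁.rel s t → μ₂.rel (s.applySub g) (t.applySub g) := by
    refine joinRel.map fun r hr => ?_
    obtain ⟨m, hm, rfl⟩ := List.mem_map.1 hr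
    obtain ⟨i, rfl⟩ := (List.mem_ofFn' _ _).1 hm
    exact ⟨_, List.mem_map_of_mem (List.getElem_mem (hmi i)),
      fun s t => PieceUnif.rel_of_pullback_rel (hpu₂ i).2.2.2.1⟩
  have hadm₁ : RelAdmissible μ₁.rel := fun c c' hc => hadm c c' (hjoin hc)
  have heq₁ : Equivalence μ₁.rel := joinRel_equivalence _
  obtain ⟨u₁, hu₁⟩ := exists_isAssocSub heq₁ hadm₁
  have hcomp : ∀ a : FOAtom P V C, (a.applySub u₁).applySub (fun v => (g v).applySub u₂) =
      (a.applySub g).applySub u₂ := by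
    intro a
    rw [FOAtom.applySub_applySub, FOAtom.applySub_applySub]
    refine FOAtom.applySub_congr fun t _ => ?_
    rw [← FOTerm.applySub_applySub, ← FOTerm.applySub_applySub, ← FOTerm.applySub_applySub]
    exact hu₂.1 _ _ (hjoin (heq₁.symm (hu₁.2.1 t)))
  refine ⟨μ₁, ⟨?_, ?_, ?_, ?_, ?_, ?_, hadm₁⟩, u₁, hu₁, fun v => (g v).applySub u₂, ?_⟩
  · simp [μ₁]
  · simp [μ₁]
  · intro i hi
    have hi' : i < R.heads.length := by simpa [μ₁] using hi
    refine ⟨Q₁ ⟨i, hi'⟩, hQ₁ _, fun v => f (i, v), fun v w hvw => (Prod.mk.inj (hf hvw)).2, ?_⟩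
    simp [μ₁, cp]
  · intro i hi
    have hi' : i < R.heads.length := by simpa [μ₁] using hi
    refine Finset.disjoint_left.2 fun v hv => ?_
    obtain ⟨w, rfl⟩ := hcpvars ⟨i, hi'⟩ v (by simpa [μ₁] using hv)
    exact hfR _
  · intro i j hi hj hij
    have hi' : i < R.heads.length := by simpa [μ₁] using hi
    have hj' : j < R.heads.length := by simpa [μ₁] using hj
    refine Finset.disjoint_left.2 fun v hv hv' => ?_
    obtain ⟨w, rfl⟩ := hcpvars ⟨i, hi'⟩ v (by simpa [μ₁] using hv)
    obtain ⟨w', hw'⟩ := hcpvars ⟨j, hj'⟩ _ (by simpa [μ₁] using hv')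
    exact hij (Prod.mk.inj (hf hw')).1
  · intro i hi _ _
    simpa [μ₁] using hpu₁ ⟨i, hi⟩
  · intro x hx
    rcases mem_betaRw_iff.1 hx with ⟨a, ha, rfl⟩ | ⟨i, hi, hi', a, ha, rfl⟩
    · refine mem_betaRw_iff.2 (Or.inl ⟨a, ha, ?_⟩)
      have hbody : ∀ v ∈ varsFS R.body, g v = FOTerm.var v :=
        fun v hv => hgR v (varsFS_body_subset_vars R hv)
      rw [hcomp, FOAtom.applySub_applySub]
      refine FOAtom.applySub_congr fun t ht => ?_
      rw [← FOTerm.applySub_applySub, FOTerm.applySub_eq_self_of_mem_args hbody ha ht]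
    · have hin : i < R.heads.length := by simpa [μ₁] using hi
      rw [hcomp]
      refine mem_betaRw_iff.2 (Or.inr ⟨i, hlQ ▸ hin, hlm ▸ hin, _, ?_, rfl⟩)
      simp only [μ₁, List.getElem_ofFn, Finset.mem_sdiff, PieceUnif.mem_pullback_Q'] at ha
      exact Finset.mem_sdiff.2 ⟨hghom ⟨i, hin⟩ a ha.1, fun h => ha.2 ⟨ha.1, h⟩⟩
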